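/- arXiv:2205.01269 — 16 statements merged into one kernel-verified Lean document; each statement's English description precedes it below -/
import Mathlib

section
/- Let I be a fuzzy implication, A an aggregation function and N a fuzzy negation. If I satisfies (A4) with A and N, then A is a conjunctor, i.e., A(0,1) = A(1,0) = 0. -/
open Set
open scoped ENNReal

/-- A fuzzy negation on the unit interval: `N 0 = 1`, `N 1 = 0`, nonincreasing,
mapping `[0,1]` into `[0,1]`. -/
def IsFuzzyNegation (N : ℝ → ℝ) : Prop :=
  (∀ x ∈ Icc (0:ℝ) 1, N x ∈ Icc (0:ℝ) 1) ∧ N 0 = 1 ∧ N 1 = 0 ∧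
    ∀ x ∈ Icc (0:ℝ) 1, ∀ y ∈ Icc (0:ℝ) 1, x ≤ y → N y ≤ N x

/-- A (binary) aggregation function on the unit interval: boundary conditions
`A 0 0 = 0`, `A 1 1 = 1`, nondecreasing in each variable, mapping `[0,1]²` into `[0,1]`. -/
def IsAggregation (A : ℝ → ℝ → ℝ) : Prop :=
  (∀ x ∈ Icc (0:ℝ) 1, ∀ y ∈ Icc (0:ℝ) 1, A x y ∈ Icc (0:ℝ) 1) ∧
    A 0 0 = 0 ∧ A 1 1 = 1 ∧
    (∀ x₁ ∈ Icc (0:ℝ) 1, ∀ x₂ ∈ Icc (0:ℝ) 1, ∀ y ∈ Icc (0:ℝ) 1,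
      x₁ ≤ x₂ → A x₁ y ≤ A x₂ y) ∧
    (∀ x ∈ Icc (0:ℝ) 1, ∀ y₁ ∈ Icc (0:ℝ) 1, ∀ y₂ ∈ Icc (0:ℝ) 1,
      y₁ ≤ y₂ → A x y₁ ≤ A x y₂)

/-- A fuzzy implication on the unit interval: nonincreasing in the first variable,
nondecreasing in the second, `I 0 0 = I 1 1 = 1`, `I 1 0 = 0`, mapping `[0,1]²` into `[0,1]`. -/
def IsFuzzyImplication (I : ℝ → ℝ → ℝ) : Prop :=
  (∀ x ∈ Icc (0:ℝ) 1, ∀ y ∈ Icc (0:ℝ) 1, I x y ∈ Icc (0:ℝ) 1) ∧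
    (∀ x₁ ∈ Icc (0:ℝ) 1, ∀ x₂ ∈ Icc (0:ℝ) 1, ∀ y ∈ Icc (0:ℝ) 1,
      x₁ ≤ x₂ → I x₂ y ≤ I x₁ y) ∧
    (∀ x ∈ Icc (0:ℝ) 1, ∀ y₁ ∈ Icc (0:ℝ) 1, ∀ y₂ ∈ Icc (0:ℝ) 1,
      y₁ ≤ y₂ → I x y₁ ≤ I x y₂) ∧
    I 0 0 = 1 ∧ I 1 1 = 1 ∧ I 1 0 = 0

/-- `I` satisfies (A4) (classical modus tollens of the ACRI method) with the aggregation
function `A` and the fuzzy negation `N`: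
`sup_{b ∈ [0,1]} A (N b) (I a b) = N a` for every `a ∈ [0,1]`. -/
def SatisfiesA4 (I A : ℝ → ℝ → ℝ) (N : ℝ → ℝ) : Prop :=
  ∀ a ∈ Icc (0:ℝ) 1, sSup ((fun b => A (N b) (I a b)) '' Icc (0:ℝ) 1) = N a

/-- `I` satisfies (A5) (classical modus ponens of the ACRI method) with the aggregation
function `A`: `sup_{a ∈ [0,1]} A a (I a b) = b` for every `b ∈ [0,1]`. -/
def SatisfiesA5 (I A : ℝ → ℝ → ℝ) : Prop :=
  ∀ b ∈ Icc (0:ℝ) 1, sSup ((fun a => A a (I a b)) '' Icc (0:ℝ) 1) = b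

/-- If a fuzzy implication `I` satisfies (A4) with an aggregation function `A`
and a fuzzy negation `N`, then `A` is a conjunctor, i.e. `A 0 1 = A 1 0 = 0`. -/
theorem stmt0 (I A : ℝ → ℝ → ℝ) (N : ℝ → ℝ)
    (hI : IsFuzzyImplication I) (hA : IsAggregation A) (hN : IsFuzzyNegation N)
    (h4 : SatisfiesA4 I A N) : A 0 1 = 0 ∧ A 1 0 = 0 := by
  have zero_mem : (0:ℝ) ∈ Icc (0:ℝ) 1 := ⟨le_rfl, zero_le_one⟩
  have one_mem : (1:ℝ) ∈ Icc (0:ℝ) 1 := ⟨zero_le_one, le_rfl⟩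
  obtain ⟨hI_mem, -, -, -, hI11, hI10⟩ := hI
  obtain ⟨hA_mem, -⟩ := hA
  obtain ⟨hN_mem, hN0, hN1, -⟩ := hN
  have bdd : BddAbove ((fun b => A (N b) (I 1 b)) '' Icc (0:ℝ) 1) :=
    ⟨1, by
      rintro _ ⟨b, hb, rfl⟩
      exact (hA_mem _ (hN_mem b hb) _ (hI_mem 1 one_mem b hb)).2⟩
  have le_zero : ∀ b ∈ Icc (0:ℝ) 1, A (N b) (I 1 b) ≤ 0 := fun b hb =>
    (le_csSup bdd (mem_image_of_mem _ hb)).trans_eq ((h4 1 one_mem).trans hN1)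
  have h01 := le_zero 1 one_mem
  have h10 := le_zero 0 zero_mem
  rw [hN1, hI11] at h01
  rw [hN0, hI10] at h10
  exact ⟨h01.antisymm (hA_mem 0 zero_mem 1 one_mem).1,
    h10.antisymm (hA_mem 1 one_mem 0 zero_mem).1⟩
end

section
/- Let I be a fuzzy implication fulfilling (NP) and A a conjunctor having 1 as a neutral element (A(1,x) = A(x,1) = x for all x). If I satisfies (A4) with A and a fuzzy negation N, then N_I(x) ≤ N(x) ≤ N_A(x) for all x ∈ [0,1], where N_I(x) = I(x,0) is the natural negation of I and N_A(x) = sup{t ∈ [0,1] : A(t,x) = 0} is the natural negation of A. -/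
open Set
open scoped ENNReal

/-- If `I` fulfills (NP), `A` is a conjunctor with neutral element 1, and `I`
satisfies (A4) with `A` and a fuzzy negation `N`, then `N_I ≤ N ≤ N_A`, where
`N_I x = I x 0` and `N_A x = sup {t ∈ [0,1] | A t x = 0}`. -/
theorem stmt1 (I A : ℝ → ℝ → ℝ) (N : ℝ → ℝ)
    (hI : IsFuzzyImplication I) (hNP : ∀ y ∈ Icc (0:ℝ) 1, I 1 y = y)
    (hA : IsAggregation A) (hAconj : A 1 0 = 0 ∧ A 0 1 = 0)
    (hAneut : ∀ x ∈ Icc (0:ℝ) 1, A 1 x = x ∧ A x 1 = x)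
    (hN : IsFuzzyNegation N) (h4 : SatisfiesA4 I A N) :
    ∀ x ∈ Icc (0:ℝ) 1, I x 0 ≤ N x ∧ N x ≤ sSup {t | t ∈ Icc (0:ℝ) 1 ∧ A t x = 0} := by
  obtain ⟨hIrange, -⟩ := hI
  obtain ⟨hArange, -⟩ := hA
  obtain ⟨hNrange, hN0, hN1, -⟩ := hN
  have h0 : (0:ℝ) ∈ Icc (0:ℝ) 1 := ⟨le_rfl, zero_le_one⟩
  have h1 : (1:ℝ) ∈ Icc (0:ℝ) 1 := ⟨zero_le_one, le_rfl⟩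
  have le_neg : ∀ a ∈ Icc (0:ℝ) 1, ∀ b ∈ Icc (0:ℝ) 1, A (N b) (I a b) ≤ N a := by
    intro a ha b hb
    rw [← h4 a ha]
    refine le_csSup ⟨1, ?_⟩ (mem_image_of_mem (fun b => A (N b) (I a b)) hb)
    rintro _ ⟨c, hc, rfl⟩
    exact (hArange _ (hNrange c hc) _ (hIrange a ha c hc)).2
  intro x hx
  constructor
  · have h := le_neg x hx 0 h0
    rwa [hN0, (hAneut _ (hIrange x hx 0 h0)).1] at h
  · have h := le_neg 1 h1 x hx
    rw [hNP x hx, hN1] at h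
    exact le_csSup ⟨1, fun t ht => ht.1.2⟩
      ⟨hNrange x hx, le_antisymm h (hArange _ (hNrange x hx) x hx).1⟩
end

section
/- Let I be a fuzzy implication fulfilling (IP), A an aggregation function with right neutral element 1 (A(x,1) = x for all x), and N a fuzzy negation. Then I satisfies (A4) with A and N if and only if A(N(b), I(a,b)) ≤ N(a) holds for all a, b ∈ [0,1]. -/
open Set
open scoped ENNReal

/-- Let `I` fulfill (IP), `A` be an aggregation function with right neutral
element 1 and `N` a fuzzy negation. Then `I` satisfies (A4) with `A` and `N` iff
`A (N b) (I a b) ≤ N a` for all `a, b ∈ [0,1]`. -/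
theorem stmt2 (I A : ℝ → ℝ → ℝ) (N : ℝ → ℝ)
    (hI : IsFuzzyImplication I) (hIP : ∀ x ∈ Icc (0:ℝ) 1, I x x = 1)
    (hA : IsAggregation A) (hAneut : ∀ x ∈ Icc (0:ℝ) 1, A x 1 = x)
    (hN : IsFuzzyNegation N) :
    SatisfiesA4 I A N ↔
      ∀ a ∈ Icc (0:ℝ) 1, ∀ b ∈ Icc (0:ℝ) 1, A (N b) (I a b) ≤ N a := by
  constructor
  · intro h a ha b hb
    rw [← h a ha]
    refine le_csSup ⟨1, ?_⟩ (mem_image_of_mem _ hb)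
    rintro _ ⟨c, hc, rfl⟩
    exact (hA.1 _ (hN.1 c hc) _ (hI.1 a ha c hc)).2
  · intro h a ha
    refine IsGreatest.csSup_eq ⟨⟨a, ha, ?_⟩, ?_⟩
    · simp only [hIP a ha, hAneut _ (hN.1 a ha)]
    · rintro _ ⟨b, hb, rfl⟩
      exact h a ha b hb
end

section
/- Let I be a fuzzy implication and A an aggregation function having 1 as a neutral element (A(1,x) = A(x,1) = x for all x). Then I satisfies (A4) with A and the natural negation N_I (given by N_I(x) = I(x,0)) if and only if A(N_I(b), I(a,b)) ≤ N_I(a) holds for all a, b ∈ [0,1]. -/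
open Set
open scoped ENNReal

/-- Let `A` have 1 as a neutral element. Then a fuzzy implication `I`
satisfies (A4) with `A` and the natural negation `N_I x = I x 0` iff
`A (N_I b) (I a b) ≤ N_I a` for all `a, b ∈ [0,1]`. -/
theorem stmt3 (I A : ℝ → ℝ → ℝ)
    (hI : IsFuzzyImplication I) (hA : IsAggregation A)
    (hAneut : ∀ x ∈ Icc (0:ℝ) 1, A 1 x = x ∧ A x 1 = x) :
    SatisfiesA4 I A (fun x => I x 0) ↔
      ∀ a ∈ Icc (0:ℝ) 1, ∀ b ∈ Icc (0:ℝ) 1, A (I b 0) (I a b) ≤ I a 0 := by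
  have h0 : (0:ℝ) ∈ Icc (0:ℝ) 1 := left_mem_Icc.2 zero_le_one
  obtain ⟨hImem, -, -, hI00, -, -⟩ := hI
  constructor
  · intro h a ha b hb
    have hbdd : BddAbove ((fun b => A (I b 0) (I a b)) '' Icc (0:ℝ) 1) := by
      refine ⟨1, ?_⟩
      rintro _ ⟨c, hc, rfl⟩
      exact (hA.1 _ (hImem c hc 0 h0) _ (hImem a ha c hc)).2
    exact (le_csSup hbdd (mem_image_of_mem _ hb)).trans_eq (h a ha)
  · intro h a ha
    refine IsGreatest.csSup_eq ⟨⟨0, h0, ?_⟩, ?_⟩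
    · simp only [hI00, (hAneut _ (hImem a ha 0 h0)).1]
    · rintro _ ⟨b, hb, rfl⟩
      exact h a ha b hb
end

section
/- Let N be an injective fuzzy negation and A an aggregation function with right neutral element 1 (A(x,1) = x for all x). If there exist a, b with 1 > a > b > 0 such that I(a,b) = 1, then the fuzzy implication I does not satisfy (A4) with A and N. -/
open Set
open scoped ENNReal

/-- Let `N` be an injective fuzzy negation and `A` an aggregation function
with right neutral element 1. If there exist `1 > a > b > 0` with `I a b = 1`, then the
fuzzy implication `I` does not satisfy (A4) with `A` and `N`. -/
theorem stmt4 (I A : ℝ → ℝ → ℝ) (N : ℝ → ℝ)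
    (hI : IsFuzzyImplication I) (hA : IsAggregation A) (hN : IsFuzzyNegation N)
    (hNinj : ∀ x ∈ Icc (0:ℝ) 1, ∀ y ∈ Icc (0:ℝ) 1, N x = N y → x = y)
    (hAneut : ∀ x ∈ Icc (0:ℝ) 1, A x 1 = x)
    (a b : ℝ) (hb : 0 < b) (hba : b < a) (ha : a < 1) (hIab : I a b = 1) :
    ¬ SatisfiesA4 I A N := by
  intro h
  obtain ⟨hIm, -⟩ := hI
  obtain ⟨hAm, -⟩ := hA
  obtain ⟨hNm, -, -, hNanti⟩ := hN
  have haI : a ∈ Icc (0:ℝ) 1 := ⟨by linarith, ha.le⟩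
  have hbI : b ∈ Icc (0:ℝ) 1 := ⟨hb.le, by linarith⟩
  have hbdd : BddAbove ((fun b => A (N b) (I a b)) '' Icc (0:ℝ) 1) := by
    refine ⟨1, ?_⟩
    rintro _ ⟨x, hx, rfl⟩
    exact (hAm _ (hNm x hx) _ (hIm a haI x hx)).2
  have hle : A (N b) (I a b) ≤ N a := h a haI ▸ le_csSup hbdd ⟨b, hbI, rfl⟩
  rw [hIab, hAneut _ (hNm b hbI)] at hle
  exact hba.ne (hNinj b hbI a haI (le_antisymm hle (hNanti b hbI a haI hba.le)))
end

section
/- Let the fuzzy implication I satisfy (A4) with an aggregation function A and a fuzzy negation N. If N is not the smallest fuzzy negation N_⊥ (i.e., there exists x ∈ (0,1] with N(x) > 0) and I(1,b) > 0 holds for every b > 0, then A has zero divisors, i.e., there exist x, y ∈ (0,1] such that A(x,y) = 0. -/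
open Set
open scoped ENNReal

/-- Let `I` satisfy (A4) with `A` and `N`. If `N ≠ N_⊥` (there is `x ∈ (0,1]`
with `N x > 0`) and `I 1 b > 0` for all `b ∈ (0,1]`, then `A` has zero divisors. -/
theorem stmt5 (I A : ℝ → ℝ → ℝ) (N : ℝ → ℝ)
    (hI : IsFuzzyImplication I) (hA : IsAggregation A) (hN : IsFuzzyNegation N)
    (h4 : SatisfiesA4 I A N)
    (hNbot : ∃ x ∈ Ioc (0:ℝ) 1, 0 < N x)
    (hI1 : ∀ b ∈ Ioc (0:ℝ) 1, 0 < I 1 b) :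
    ∃ x ∈ Ioc (0:ℝ) 1, ∃ y ∈ Ioc (0:ℝ) 1, A x y = 0 := by
  obtain ⟨x, hx, hNx⟩ := hNbot
  have hx' : x ∈ Icc (0:ℝ) 1 := ⟨hx.1.le, hx.2⟩
  have h1 : (1:ℝ) ∈ Icc (0:ℝ) 1 := ⟨zero_le_one, le_rfl⟩
  have hbdd : BddAbove ((fun b => A (N b) (I 1 b)) '' Icc (0:ℝ) 1) := by
    refine ⟨1, ?_⟩
    rintro _ ⟨b, hb, rfl⟩
    exact (hA.1 _ (hN.1 b hb) _ (hI.1 1 h1 b hb)).2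
  have hle : A (N x) (I 1 x) ≤ sSup ((fun b => A (N b) (I 1 b)) '' Icc (0:ℝ) 1) :=
    le_csSup hbdd ⟨x, hx', rfl⟩
  rw [h4 1 h1, hN.2.2.1] at hle
  exact ⟨N x, ⟨hNx, (hN.1 x hx').2⟩, I 1 x, ⟨hI1 x hx, (hI.1 1 h1 x hx').2⟩,
    le_antisymm hle (hA.1 _ (hN.1 x hx') _ (hI.1 1 h1 x hx')).1⟩
end

section
/- Let I be a fuzzy implication fulfilling (NP) and A an aggregation function with left neutral element 1 (A(1,x) = x for all x). Then I satisfies (A5) with A if and only if A(a, I(a,b)) ≤ b holds for all a, b ∈ [0,1]. -/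
open Set
open scoped ENNReal

/-- Let `I` fulfill (NP) and `A` have left neutral element 1. Then `I`
satisfies (A5) with `A` iff `A a (I a b) ≤ b` for all `a, b ∈ [0,1]`. -/
theorem stmt6 (I A : ℝ → ℝ → ℝ)
    (hI : IsFuzzyImplication I) (hNP : ∀ y ∈ Icc (0:ℝ) 1, I 1 y = y)
    (hA : IsAggregation A) (hAneut : ∀ x ∈ Icc (0:ℝ) 1, A 1 x = x) :
    SatisfiesA5 I A ↔
      ∀ a ∈ Icc (0:ℝ) 1, ∀ b ∈ Icc (0:ℝ) 1, A a (I a b) ≤ b := by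
  have hmem : ∀ b ∈ Icc (0:ℝ) 1, b ∈ (fun a => A a (I a b)) '' Icc (0:ℝ) 1 := fun b hb =>
    ⟨1, right_mem_Icc.mpr zero_le_one, by simp only [hNP b hb, hAneut b hb]⟩
  constructor
  · intro h a ha b hb
    have hbdd : BddAbove ((fun a => A a (I a b)) '' Icc (0:ℝ) 1) := by
      refine ⟨1, ?_⟩
      rintro _ ⟨x, hx, rfl⟩
      exact (hA.1 x hx _ (hI.1 x hx b hb)).2
    exact (le_csSup hbdd (mem_image_of_mem _ ha)).trans_eq (h b hb)
  · intro h b hb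
    refine IsGreatest.csSup_eq ⟨hmem b hb, ?_⟩
    rintro _ ⟨a, ha, rfl⟩
    exact h a ha b hb
end

section
/- Let A be an aggregation function with right neutral element 1 (A(x,1) = x for all x). If there exist a, b with 1 > a > b > 0 such that I(a,b) = 1, then the fuzzy implication I does not satisfy (A5) with A. -/
open Set
open scoped ENNReal

/-- Let `A` have right neutral element 1. If there exist `1 > a > b > 0`
with `I a b = 1`, then the fuzzy implication `I` does not satisfy (A5) with `A`. -/
theorem stmt7 (I A : ℝ → ℝ → ℝ)
    (hI : IsFuzzyImplication I) (hA : IsAggregation A)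
    (hAneut : ∀ x ∈ Icc (0:ℝ) 1, A x 1 = x)
    (a b : ℝ) (hb : 0 < b) (hba : b < a) (ha : a < 1) (hIab : I a b = 1) :
    ¬ SatisfiesA5 I A := by
  intro h
  have haI : a ∈ Icc (0:ℝ) 1 := ⟨(hb.trans hba).le, ha.le⟩
  have hbI : b ∈ Icc (0:ℝ) 1 := ⟨hb.le, (hba.trans ha).le⟩
  have hbdd : BddAbove ((fun x => A x (I x b)) '' Icc (0:ℝ) 1) := by
    refine ⟨1, ?_⟩
    rintro _ ⟨x, hx, rfl⟩
    exact (hA.1 x hx _ (hI.1 x hx b hbI)).2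
  have hle : A a (I a b) ≤ b := (le_csSup hbdd (mem_image_of_mem _ haI)).trans_eq (h b hbI)
  rw [hIab, hAneut a haI] at hle
  exact hle.not_gt hba
end

section
/- Let the fuzzy implication I fulfill (OP) and let A be a commutative aggregation function. If I satisfies the law of importation (LIA) with A, i.e., I(A(x,y), z) = I(x, I(y,z)) for all x, y, z ∈ [0,1], then I satisfies the A-conditionality (AC) with A, i.e., A(a, I(a,b)) ≤ b for all a, b ∈ [0,1]. -/
open Set
open scoped ENNReal

/-- Let `I` fulfill (OP) and `A` be a commutative aggregation function.
If `I` satisfies the law of importation (LIA) with `A`, then `I` satisfies the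
`A`-conditionality `A a (I a b) ≤ b` for all `a, b ∈ [0,1]`. -/
theorem stmt8 (I A : ℝ → ℝ → ℝ)
    (hI : IsFuzzyImplication I)
    (hOP : ∀ x ∈ Icc (0:ℝ) 1, ∀ y ∈ Icc (0:ℝ) 1, (I x y = 1 ↔ x ≤ y))
    (hA : IsAggregation A)
    (hAcomm : ∀ x ∈ Icc (0:ℝ) 1, ∀ y ∈ Icc (0:ℝ) 1, A x y = A y x)
    (hLIA : ∀ x ∈ Icc (0:ℝ) 1, ∀ y ∈ Icc (0:ℝ) 1, ∀ z ∈ Icc (0:ℝ) 1,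
      I (A x y) z = I x (I y z)) :
    ∀ a ∈ Icc (0:ℝ) 1, ∀ b ∈ Icc (0:ℝ) 1, A a (I a b) ≤ b := by
  intro a ha b hb
  have hab := hI.1 a ha b hb
  rw [← hOP _ (hA.1 a ha _ hab) b hb, hAcomm a ha _ hab, hLIA _ hab a ha b hb,
    hOP _ hab _ hab]
end

section
/- Let I and J be two fuzzy implications fulfilling (NP) with J(a,b) ≤ I(a,b) for all a, b ∈ [0,1], and let A be an aggregation function with left neutral element 1 (A(1,x) = x for all x). If I satisfies (A5) with A, then J satisfies (A5) with A. -/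
open Set
open scoped ENNReal

/-- Let `I`, `J` be fuzzy implications fulfilling (NP) with `J ≤ I`, and
let `A` have left neutral element 1. If `I` satisfies (A5) with `A`, so does `J`. -/
theorem stmt9 (I J A : ℝ → ℝ → ℝ)
    (hI : IsFuzzyImplication I) (hJ : IsFuzzyImplication J)
    (hINP : ∀ y ∈ Icc (0:ℝ) 1, I 1 y = y) (hJNP : ∀ y ∈ Icc (0:ℝ) 1, J 1 y = y)
    (hJI : ∀ a ∈ Icc (0:ℝ) 1, ∀ b ∈ Icc (0:ℝ) 1, J a b ≤ I a b)
    (hA : IsAggregation A) (hAneut : ∀ x ∈ Icc (0:ℝ) 1, A 1 x = x)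
    (h5 : SatisfiesA5 I A) : SatisfiesA5 J A := by
  intro b hb
  have h1 : (1 : ℝ) ∈ Icc (0:ℝ) 1 := right_mem_Icc.mpr zero_le_one
  refine IsGreatest.csSup_eq ⟨⟨1, h1, ?_⟩, ?_⟩
  · simp only [hJNP b hb, hAneut b hb]
  · rintro _ ⟨a, ha, rfl⟩
    have hbdd : BddAbove ((fun a => A a (I a b)) '' Icc (0:ℝ) 1) := by
      refine ⟨1, ?_⟩
      rintro _ ⟨c, hc, rfl⟩
      exact (hA.1 c hc _ (hI.1 c hc b hb)).2
    calc A a (J a b) ≤ A a (I a b) :=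
          hA.2.2.2.2 a ha _ (hJ.1 a ha b hb) _ (hI.1 a ha b hb) (hJI a ha b hb)
      _ ≤ sSup ((fun a => A a (I a b)) '' Icc (0:ℝ) 1) :=
          le_csSup hbdd (mem_image_of_mem _ ha)
      _ = b := h5 b hb
end

section
/- Let φ be an automorphism of [0,1] (an increasing bijection of [0,1] onto itself), I a fuzzy implication, A an aggregation function and N a fuzzy negation, and define the φ-conjugates I_φ(x,y) = φ⁻¹(I(φ(x), φ(y))), A_φ(x,y) = φ⁻¹(A(φ(x), φ(y))) and N_φ(x) = φ⁻¹(N(φ(x))). Then: (i) if I satisfies (A4) with A and N, then I_φ satisfies (A4) with A_φ and N_φ; (ii) if I satisfies (A5) with A, then I_φ satisfies (A5) with A_φ. -/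
open Set
open scoped ENNReal

/-- Conjugating a self-map of `[0,1]` by an automorphism `φ` of `[0,1]` transports its supremum
along the inverse of `φ`. -/
theorem sSup_image_conj {φ φinv f g : ℝ → ℝ} {c : ℝ}
    (hφmono : StrictMonoOn φ (Icc (0:ℝ) 1))
    (hφbij : BijOn φ (Icc (0:ℝ) 1) (Icc (0:ℝ) 1))
    (hφinv : ∀ x ∈ Icc (0:ℝ) 1, φ (φinv x) = x ∧ φinv x ∈ Icc (0:ℝ) 1)
    (hf : ∀ x ∈ Icc (0:ℝ) 1, f x ∈ Icc (0:ℝ) 1) (hc : c ∈ Icc (0:ℝ) 1)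
    (hg : ∀ x ∈ Icc (0:ℝ) 1, g x = φinv (f (φ x)))
    (h : sSup (f '' Icc (0:ℝ) 1) = c) :
    sSup (g '' Icc (0:ℝ) 1) = φinv c := by
  have hne : (Icc (0:ℝ) 1).Nonempty := ⟨0, by simp⟩
  have hbdd : BddAbove (f '' Icc (0:ℝ) 1) := ⟨1, by
    rintro _ ⟨x, hx, rfl⟩
    exact (hf x hx).2⟩
  have hlub : IsLUB (f '' Icc (0:ℝ) 1) c := h ▸ isLUB_csSup (hne.image f) hbdd
  refine IsLUB.csSup_eq ⟨?_, fun u hu => ?_⟩ (hne.image g)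
  · rintro _ ⟨x, hx, rfl⟩
    have hfx := hf _ (hφbij.mapsTo hx)
    rw [hg x hx, ← hφmono.le_iff_le (hφinv _ hfx).2 (hφinv c hc).2, (hφinv _ hfx).1,
      (hφinv c hc).1]
    exact hlub.1 ⟨_, hφbij.mapsTo hx, rfl⟩
  · by_cases hu1 : 1 ≤ u
    · exact (hφinv c hc).2.2.trans hu1
    have hgu : ∀ x ∈ Icc (0:ℝ) 1, φinv (f (φ x)) ≤ u := fun x hx =>
      hg x hx ▸ hu ⟨x, hx, rfl⟩
    have huI : u ∈ Icc (0:ℝ) 1 :=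
      ⟨(hφinv _ (hf _ (hφbij.mapsTo (by simp : (0:ℝ) ∈ Icc (0:ℝ) 1)))).2.1.trans
        (hgu 0 (by simp)), (not_le.1 hu1).le⟩
    rw [← hφmono.le_iff_le (hφinv c hc).2 huI, (hφinv c hc).1]
    refine hlub.2 ?_
    rintro _ ⟨y, hy, rfl⟩
    obtain ⟨x, hx, rfl⟩ := hφbij.surjOn hy
    have hfx := hf _ hy
    rw [← (hφinv _ hfx).1, hφmono.le_iff_le (hφinv _ hfx).2 huI]
    exact hgu x hx

/-- For an automorphism `φ` of `[0,1]` (with inverse `φinv`):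
(i) if `I` satisfies (A4) with `A` and `N`, then `I_φ` satisfies (A4) with `A_φ` and `N_φ`;
(ii) if `I` satisfies (A5) with `A`, then `I_φ` satisfies (A5) with `A_φ`. -/
theorem stmt10 (φ φinv : ℝ → ℝ) (I A : ℝ → ℝ → ℝ) (N : ℝ → ℝ)
    (hφmono : StrictMonoOn φ (Icc (0:ℝ) 1))
    (hφbij : BijOn φ (Icc (0:ℝ) 1) (Icc (0:ℝ) 1))
    (hφinv : ∀ x ∈ Icc (0:ℝ) 1, φinv (φ x) = x ∧ φ (φinv x) = x ∧ φinv x ∈ Icc (0:ℝ) 1)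
    (hI : IsFuzzyImplication I) (hA : IsAggregation A) (hN : IsFuzzyNegation N) :
    (SatisfiesA4 I A N →
      SatisfiesA4 (fun x y => φinv (I (φ x) (φ y))) (fun x y => φinv (A (φ x) (φ y)))
        (fun x => φinv (N (φ x)))) ∧
    (SatisfiesA5 I A →
      SatisfiesA5 (fun x y => φinv (I (φ x) (φ y))) (fun x y => φinv (A (φ x) (φ y)))) := by
  have hinv : ∀ x ∈ Icc (0:ℝ) 1, φ (φinv x) = x ∧ φinv x ∈ Icc (0:ℝ) 1 :=
    fun x hx => (hφinv x hx).2
  refine ⟨fun h a ha => ?_, fun h b hb => ?_⟩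
  · have hφa := hφbij.mapsTo ha
    refine sSup_image_conj hφmono hφbij hinv
      (fun y hy => hA.1 _ (hN.1 _ hy) _ (hI.1 _ hφa _ hy)) (hN.1 _ hφa) (fun x hx => ?_)
      (h (φ a) hφa)
    have hφx := hφbij.mapsTo hx
    simp only [(hinv _ (hN.1 _ hφx)).1, (hinv _ (hI.1 _ hφa _ hφx)).1]
  · have hφb := hφbij.mapsTo hb
    refine (sSup_image_conj hφmono hφbij hinv
      (fun y hy => hA.1 _ hy _ (hI.1 _ hy _ hφb)) hφb (fun x hx => ?_)
      (h (φ b) hφb)).trans (hφinv b hb).1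
    simp only [(hinv _ (hI.1 _ (hφbij.mapsTo hx) _ hφb)).1]
end

section
/- Let I be a fuzzy implication such that I(1,b) < 1 for every b ∈ [0,1), and define A_I(a,b) = inf{c ∈ [0,1] : I(a,c) ≥ b}. Then A_I is an aggregation function and A_I(a, I(a,b)) ≤ b holds for all a, b ∈ [0,1]. -/
open Set
open scoped ENNReal

/-- The set defining `A_I a b` is bounded below by `0`. -/
theorem bddBelow_residual_set (I : ℝ → ℝ → ℝ) (a b : ℝ) :
    BddBelow {c | c ∈ Icc (0:ℝ) 1 ∧ b ≤ I a c} :=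
  ⟨0, fun _ hc => hc.1.1⟩

theorem IsFuzzyImplication.apply_one {I : ℝ → ℝ → ℝ} (hI : IsFuzzyImplication I)
    {a : ℝ} (ha : a ∈ Icc (0:ℝ) 1) : I a 1 = 1 := by
  obtain ⟨hmem, hanti, -, -, h11, -⟩ := hI
  have h1 : (1:ℝ) ∈ Icc (0:ℝ) 1 := right_mem_Icc.2 zero_le_one
  exact le_antisymm (hmem a ha 1 h1).2 (h11.ge.trans (hanti a ha 1 h1 1 h1 ha.2))

theorem IsFuzzyImplication.one_mem_residual_set {I : ℝ → ℝ → ℝ} (hI : IsFuzzyImplication I)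
    {a b : ℝ} (ha : a ∈ Icc (0:ℝ) 1) (hb : b ≤ 1) :
    (1:ℝ) ∈ {c | c ∈ Icc (0:ℝ) 1 ∧ b ≤ I a c} :=
  ⟨right_mem_Icc.2 zero_le_one, hb.trans_eq (hI.apply_one ha).symm⟩

/-- Let `I` be a fuzzy implication with `I 1 b < 1` for every `b ∈ [0,1)`,
and define `A_I a b = inf {c ∈ [0,1] | I a c ≥ b}`. Then `A_I` is an aggregation
function and `A_I a (I a b) ≤ b` for all `a, b ∈ [0,1]`. -/
theorem stmt11 (I : ℝ → ℝ → ℝ)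
    (hI : IsFuzzyImplication I)
    (hI1 : ∀ b ∈ Ico (0:ℝ) 1, I 1 b < 1) :
    IsAggregation (fun a b => sInf {c | c ∈ Icc (0:ℝ) 1 ∧ b ≤ I a c}) ∧
      ∀ a ∈ Icc (0:ℝ) 1, ∀ b ∈ Icc (0:ℝ) 1,
        sInf {c | c ∈ Icc (0:ℝ) 1 ∧ I a b ≤ I a c} ≤ b := by
  have h1 : (1:ℝ) ∈ Icc (0:ℝ) 1 := right_mem_Icc.2 zero_le_one
  have h0 : (0:ℝ) ∈ Icc (0:ℝ) 1 := left_mem_Icc.2 zero_le_one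
  have nonneg (a b : ℝ) : 0 ≤ sInf {c | c ∈ Icc (0:ℝ) 1 ∧ b ≤ I a c} :=
    Real.sInf_nonneg fun _ hc => hc.1.1
  refine ⟨⟨fun x hx y hy => ⟨nonneg x y, ?_⟩, ?_, ?_, ?_, ?_⟩, fun a _ b hb => ?_⟩
  · exact csInf_le (bddBelow_residual_set I x y) (hI.one_mem_residual_set hx hy.2)
  · exact le_antisymm (csInf_le (bddBelow_residual_set I 0 0) ⟨h0, (hI.1 0 h0 0 h0).1⟩)
      (nonneg 0 0)
  · refine le_antisymm (csInf_le (bddBelow_residual_set I 1 1)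
      (hI.one_mem_residual_set h1 le_rfl)) ?_
    refine le_csInf ⟨1, hI.one_mem_residual_set h1 le_rfl⟩ fun c hc => ?_
    by_contra! hlt
    exact (hI1 c ⟨hc.1.1, hlt⟩).not_ge hc.2
  · intro x₁ hx₁ x₂ hx₂ y hy h
    exact csInf_le_csInf (bddBelow_residual_set I x₁ y)
      ⟨1, hI.one_mem_residual_set hx₂ hy.2⟩
      fun c hc => ⟨hc.1, hc.2.trans (hI.2.1 x₁ hx₁ x₂ hx₂ c hc.1 h)⟩
  · intro x hx y₁ _ y₂ hy₂ h
    exact csInf_le_csInf (bddBelow_residual_set I x y₁)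
      ⟨1, hI.one_mem_residual_set hx hy₂.2⟩
      fun c hc => ⟨hc.1, h.trans hc.2⟩
  · exact csInf_le (bddBelow_residual_set I a (I a b)) ⟨hb, le_rfl⟩
end

section
/- Let I be a fuzzy implication fulfilling (NP), and define A_I(a,b) = inf{c ∈ [0,1] : I(a,c) ≥ b}. Then I satisfies (A5) with A_I. -/
open Set
open scoped ENNReal

/-- Let `I` be a fuzzy implication fulfilling (NP), and define
`A_I a b = inf {c ∈ [0,1] | I a c ≥ b}`. Then `I` satisfies (A5) with `A_I`. -/
theorem stmt12 (I : ℝ → ℝ → ℝ)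
    (hI : IsFuzzyImplication I) (hNP : ∀ y ∈ Icc (0:ℝ) 1, I 1 y = y) :
    SatisfiesA5 I (fun a b => sInf {c | c ∈ Icc (0:ℝ) 1 ∧ b ≤ I a c}) := by
  intro b hb
  refine IsGreatest.csSup_eq ⟨⟨1, right_mem_Icc.2 zero_le_one, ?_⟩, ?_⟩
  · refine IsLeast.csInf_eq ⟨⟨hb, le_rfl⟩, ?_⟩
    rintro c ⟨hc, hbc⟩
    rwa [hNP b hb, hNP c hc] at hbc
  · rintro _ ⟨a, -, rfl⟩
    exact csInf_le ⟨0, fun c hc => hc.1.1⟩ ⟨hb, le_rfl⟩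
end

section
/- Let A and A' be two conjunctors, each having left neutral element 1 (A(1,x) = A'(1,x) = x for all x), and assume A is left-continuous in its second variable. Let I_A be the R-implication generated by A, I_A(x,y) = sup{t ∈ [0,1] : A(x,t) ≤ y}. Then I_A satisfies (A5) with A' if and only if A'(x,y) ≤ A(x,y) for all x, y ∈ [0,1]. -/
open Set
open scoped ENNReal

/-- Residuation inequality: if `f` is left-continuous on `[0,1]` and `f 0 ≤ b`, then the supremum
of `{t ∈ [0,1] | f t ≤ b}` is attained. -/
theorem isGreatest_sSup_sublevel {f : ℝ → ℝ} {b : ℝ}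
    (hf : ∀ y ∈ Icc (0:ℝ) 1, ContinuousWithinAt f (Iic y) y) (h0 : f 0 ≤ b) :
    IsGreatest {t | t ∈ Icc (0:ℝ) 1 ∧ f t ≤ b} (sSup {t | t ∈ Icc (0:ℝ) 1 ∧ f t ≤ b}) := by
  set S : Set ℝ := {t | t ∈ Icc (0:ℝ) 1 ∧ f t ≤ b}
  have hne : S.Nonempty := ⟨0, ⟨le_rfl, zero_le_one⟩, h0⟩
  have hbdd : BddAbove S := ⟨1, fun t ht => ht.1.2⟩
  have hlub : IsLUB S (sSup S) := isLUB_csSup hne hbdd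
  have hmem : sSup S ∈ Icc (0:ℝ) 1 :=
    ⟨hlub.1 ⟨⟨le_rfl, zero_le_one⟩, h0⟩, hlub.2 fun t ht => ht.1.2⟩
  have hcont : ContinuousWithinAt f S (sSup S) := (hf _ hmem).mono fun t ht => hlub.1 ht
  have hle : f (sSup S) ∈ closure (Iic b) :=
    hcont.mem_closure (hlub.mem_closure hne) fun t ht => ht.2
  rw [isClosed_Iic.closure_eq] at hle
  exact ⟨⟨hmem, hle⟩, hlub.1⟩

/-- Let `A`, `A'` be conjunctors with left neutral element 1, `A`
left-continuous in its second variable, and `I_A x y = sup {t ∈ [0,1] | A x t ≤ y}` the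
R-implication generated by `A`. Then `I_A` satisfies (A5) with `A'` iff `A' ≤ A`. -/
theorem stmt13 (A A' : ℝ → ℝ → ℝ)
    (hA : IsAggregation A) (hA' : IsAggregation A')
    (hAconj : A 1 0 = 0 ∧ A 0 1 = 0) (hA'conj : A' 1 0 = 0 ∧ A' 0 1 = 0)
    (hAneut : ∀ x ∈ Icc (0:ℝ) 1, A 1 x = x) (hA'neut : ∀ x ∈ Icc (0:ℝ) 1, A' 1 x = x)
    (hAlc : ∀ x ∈ Icc (0:ℝ) 1, ∀ y ∈ Icc (0:ℝ) 1,
      ContinuousWithinAt (A x) (Iic y) y) :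
    SatisfiesA5 (fun x y => sSup {t | t ∈ Icc (0:ℝ) 1 ∧ A x t ≤ y}) A' ↔
      ∀ x ∈ Icc (0:ℝ) 1, ∀ y ∈ Icc (0:ℝ) 1, A' x y ≤ A x y := by
  have hone : (1:ℝ) ∈ Icc (0:ℝ) 1 := ⟨zero_le_one, le_rfl⟩
  have hzero : (0:ℝ) ∈ Icc (0:ℝ) 1 := ⟨le_rfl, zero_le_one⟩
  have hres : ∀ x ∈ Icc (0:ℝ) 1, ∀ b ∈ Icc (0:ℝ) 1,
      IsGreatest {t | t ∈ Icc (0:ℝ) 1 ∧ A x t ≤ b}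
        (sSup {t | t ∈ Icc (0:ℝ) 1 ∧ A x t ≤ b}) := fun x hx b hb =>
    isGreatest_sSup_sublevel (hAlc x hx)
      (((hA.2.2.2.1 x hx 1 hone 0 hzero hx.2).trans_eq hAconj.1).trans hb.1)
  constructor
  · intro h x hx y hy
    have hb := hA.1 x hx y hy
    have hI := hres x hx _ hb
    refine (hA'.2.2.2.2 x hx y hy _ hI.1.1 (hI.2 ⟨hy, le_rfl⟩)).trans ?_
    refine (le_csSup ⟨1, ?_⟩ (mem_image_of_mem _ hx)).trans_eq (h _ hb)
    rintro _ ⟨a, ha, rfl⟩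
    exact (hA'.1 a ha _ (hres a ha _ hb).1.1).2
  · intro h b hb
    refine IsGreatest.csSup_eq ⟨⟨1, hone, ?_⟩, ?_⟩
    · have hI := hres 1 hone b hb
      have hle := hI.1.2
      rw [hAneut _ hI.1.1] at hle
      exact (hA'neut _ hI.1.1).trans (hle.antisymm (hI.2 ⟨hb, (hAneut b hb).le⟩))
    · rintro _ ⟨a, ha, rfl⟩
      have hI := hres a ha b hb
      exact (h a ha _ hI.1.1).trans hI.1.2
end

section
/- Let A be an aggregation function having 1 as a neutral element (A(1,x) = A(x,1) = x for all x), let A' be a conjunctor with left neutral element 1 (A'(1,x) = x for all x), and let I_A be the R-implication generated by A. Assume I_A fulfills (OP) and (EP). Define A* on [0,1]² by A*(x,y) = sup{A(u,v) : u < x, v < y} for x, y ∈ (0,1) and A*(x,y) = A(x,y) otherwise. Then I_A satisfies (A5) with A' if and only if A'(x,y) ≤ A*(x,y) for all x, y ∈ [0,1]. -/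
open Set
open scoped ENNReal

/-- The R-implication generated by `A`. -/
noncomputable def rImplication (A : ℝ → ℝ → ℝ) (x y : ℝ) : ℝ :=
  sSup {t | t ∈ Icc (0:ℝ) 1 ∧ A x t ≤ y}

section RImplication

variable {A : ℝ → ℝ → ℝ} {x y t : ℝ}

theorem le_rImplication (ht : t ∈ Icc (0:ℝ) 1) (h : A x t ≤ y) : t ≤ rImplication A x y :=
  le_csSup ⟨1, fun _ hs => hs.1.2⟩ ⟨ht, h⟩

theorem rImplication_mem_Icc : rImplication A x y ∈ Icc (0:ℝ) 1 :=
  ⟨Real.sSup_nonneg fun _ hs => hs.1.1, Real.sSup_le (fun _ hs => hs.1.2) zero_le_one⟩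

theorem apply_le_of_lt_rImplication (hA : IsAggregation A) (hx : x ∈ Icc (0:ℝ) 1)
    (ht : t ∈ Icc (0:ℝ) 1) (h : t < rImplication A x y) : A x t ≤ y := by
  have hne : {s | s ∈ Icc (0:ℝ) 1 ∧ A x s ≤ y}.Nonempty := by
    by_contra hempty
    rw [rImplication, not_nonempty_iff_eq_empty.1 hempty, Real.sSup_empty] at h
    exact h.not_ge ht.1
  obtain ⟨s, ⟨hs, hsy⟩, hts⟩ := exists_lt_of_lt_csSup hne h
  exact (hA.2.2.2.2 x hx t ht s hs hts.le).trans hsy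

theorem rImplication_one_left (hone : ∀ x ∈ Icc (0:ℝ) 1, A 1 x = x) (hy : y ∈ Icc (0:ℝ) 1) :
    rImplication A 1 y = y :=
  le_antisymm (Real.sSup_le (fun t ht => hone t ht.1 ▸ ht.2) hy.1)
    (le_rImplication hy (hone y hy).le)

/-- The ordering and exchange properties make `x ↦ I x z` a Galois connection with itself. -/
theorem le_rImplication_comm
    (hOP : ∀ x ∈ Icc (0:ℝ) 1, ∀ y ∈ Icc (0:ℝ) 1, (rImplication A x y = 1 ↔ x ≤ y))
    (hEP : ∀ x ∈ Icc (0:ℝ) 1, ∀ y ∈ Icc (0:ℝ) 1, ∀ z ∈ Icc (0:ℝ) 1,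
      rImplication A x (rImplication A y z) = rImplication A y (rImplication A x z))
    {z : ℝ} (hx : x ∈ Icc (0:ℝ) 1) (hy : y ∈ Icc (0:ℝ) 1) (hz : z ∈ Icc (0:ℝ) 1) :
    x ≤ rImplication A y z ↔ y ≤ rImplication A x z := by
  rw [← hOP x hx _ rImplication_mem_Icc, hEP x hx y hy z hz, hOP y hy _ rImplication_mem_Icc]

/-- (A5) reduces to a pointwise inequality, the supremum being attained at `a = 1`. -/
theorem satisfiesA5_rImplication_iff {A' : ℝ → ℝ → ℝ}
    (hone : ∀ x ∈ Icc (0:ℝ) 1, A 1 x = x)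
    (hA' : IsAggregation A') (hone' : ∀ x ∈ Icc (0:ℝ) 1, A' 1 x = x) :
    SatisfiesA5 (rImplication A) A' ↔
      ∀ a ∈ Icc (0:ℝ) 1, ∀ b ∈ Icc (0:ℝ) 1, A' a (rImplication A a b) ≤ b := by
  have hbdd (b : ℝ) : BddAbove ((fun a => A' a (rImplication A a b)) '' Icc (0:ℝ) 1) := by
    refine ⟨1, ?_⟩
    rintro _ ⟨a, ha, rfl⟩
    exact (hA'.1 a ha _ rImplication_mem_Icc).2
  constructor
  · intro h a ha b hb
    exact (le_csSup (hbdd b) (mem_image_of_mem _ ha)).trans_eq (h b hb)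
  · intro h b hb
    have hone_mem : (1:ℝ) ∈ Icc (0:ℝ) 1 := ⟨zero_le_one, le_rfl⟩
    refine IsGreatest.csSup_eq ⟨⟨1, hone_mem, ?_⟩, ?_⟩
    · simp only [rImplication_one_left hone hb, hone' b hb]
    · rintro _ ⟨a, ha, rfl⟩
      exact h a ha b hb

end RImplication

/-- Let `A` have 1 as a neutral element, `A'` be a conjunctor with left
neutral element 1, and assume the R-implication `I_A` fulfills (OP) and (EP). With
`A* x y = sup {A u v | u < x, v < y}` for `x, y ∈ (0,1)` and `A* x y = A x y` otherwise,
`I_A` satisfies (A5) with `A'` iff `A' ≤ A*` on `[0,1]²`. -/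
theorem stmt15 (A A' Astar : ℝ → ℝ → ℝ)
    (hA : IsAggregation A) (hA' : IsAggregation A')
    (hAneut : ∀ x ∈ Icc (0:ℝ) 1, A 1 x = x ∧ A x 1 = x)
    (hA'conj : A' 1 0 = 0 ∧ A' 0 1 = 0)
    (hA'neut : ∀ x ∈ Icc (0:ℝ) 1, A' 1 x = x)
    (hOP : ∀ x ∈ Icc (0:ℝ) 1, ∀ y ∈ Icc (0:ℝ) 1,
      (sSup {t | t ∈ Icc (0:ℝ) 1 ∧ A x t ≤ y} = 1 ↔ x ≤ y))
    (hEP : ∀ x ∈ Icc (0:ℝ) 1, ∀ y ∈ Icc (0:ℝ) 1, ∀ z ∈ Icc (0:ℝ) 1,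
      sSup {t | t ∈ Icc (0:ℝ) 1 ∧ A x t ≤ sSup {s | s ∈ Icc (0:ℝ) 1 ∧ A y s ≤ z}} =
        sSup {t | t ∈ Icc (0:ℝ) 1 ∧ A y t ≤ sSup {s | s ∈ Icc (0:ℝ) 1 ∧ A x s ≤ z}})
    (hAstar : ∀ x y : ℝ, Astar x y =
      if x ∈ Ioo (0:ℝ) 1 ∧ y ∈ Ioo (0:ℝ) 1 then
        sSup {w | ∃ u ∈ Icc (0:ℝ) 1, ∃ v ∈ Icc (0:ℝ) 1, u < x ∧ v < y ∧ w = A u v}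
      else A x y) :
    SatisfiesA5 (fun x y => sSup {t | t ∈ Icc (0:ℝ) 1 ∧ A x t ≤ y}) A' ↔
      ∀ x ∈ Icc (0:ℝ) 1, ∀ y ∈ Icc (0:ℝ) 1, A' x y ≤ Astar x y := by
  have hOP : ∀ x ∈ Icc (0:ℝ) 1, ∀ y ∈ Icc (0:ℝ) 1, (rImplication A x y = 1 ↔ x ≤ y) := hOP
  have hone : ∀ x ∈ Icc (0:ℝ) 1, A 1 x = x := fun x hx => (hAneut x hx).1
  have zero_mem : (0:ℝ) ∈ Icc (0:ℝ) 1 := ⟨le_rfl, zero_le_one⟩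
  have one_mem : (1:ℝ) ∈ Icc (0:ℝ) 1 := ⟨zero_le_one, le_rfl⟩
  refine (satisfiesA5_rImplication_iff hone hA' hA'neut).trans ⟨fun h x hx y hy => ?_,
    fun h a ha b hb => (h a ha _ rImplication_mem_Icc).trans ?_⟩
  · have key : Astar x y ∈ Icc (0:ℝ) 1 ∧ y ≤ rImplication A x (Astar x y) := by
      rw [hAstar]
      split_ifs with hxy
      · set S := {w | ∃ u ∈ Icc (0:ℝ) 1, ∃ v ∈ Icc (0:ℝ) 1, u < x ∧ v < y ∧ w = A u v}
        have hS : S ⊆ Icc 0 1 := by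
          rintro _ ⟨u, hu, v, hv, -, -, rfl⟩
          exact hA.1 u hu v hv
        have hb : sSup S ∈ Icc (0:ℝ) 1 :=
          ⟨Real.sSup_nonneg fun w hw => (hS hw).1,
            Real.sSup_le (fun w hw => (hS hw).2) zero_le_one⟩
        refine ⟨hb, (le_rImplication_comm hOP hEP hy hx hb).2 ?_⟩
        refine le_of_forall_lt_imp_le_of_dense fun u hux => ?_
        rcases lt_or_ge u 0 with hu0 | hu0
        · exact hu0.le.trans rImplication_mem_Icc.1
        have hu : u ∈ Icc (0:ℝ) 1 := ⟨hu0, hux.le.trans hx.2⟩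
        refine (le_rImplication_comm hOP hEP hu hy hb).2 ?_
        refine le_of_forall_lt_imp_le_of_dense fun v hvy => ?_
        rcases lt_or_ge v 0 with hv0 | hv0
        · exact hv0.le.trans rImplication_mem_Icc.1
        have hv : v ∈ Icc (0:ℝ) 1 := ⟨hv0, hvy.le.trans hy.2⟩
        exact le_rImplication hv
          (le_csSup ⟨1, fun w hw => (hS hw).2⟩ ⟨u, hu, v, hv, hux, hvy, rfl⟩)
      · exact ⟨hA.1 x hx y hy, le_rImplication hy le_rfl⟩
    exact (hA'.2.2.2.2 x hx y hy _ rImplication_mem_Icc key.2).trans (h x hx _ key.1)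
  · rw [hAstar]
    split_ifs with hab
    · refine Real.sSup_le ?_ hb.1
      rintro _ ⟨u, hu, v, hv, hua, hvI, rfl⟩
      exact (hA.2.2.2.1 u hu a ha v hv hua.le).trans (apply_le_of_lt_rImplication hA ha hv hvI)
    · have hI : rImplication A a b ∈ Icc (0:ℝ) 1 := rImplication_mem_Icc
      rcases ha.1.eq_or_lt with rfl | ha0
      · exact ((hA.2.2.2.2 0 zero_mem _ hI 1 one_mem hI.2).trans_eq
          (hAneut 0 zero_mem).2).trans hb.1
      rcases ha.2.eq_or_lt with rfl | ha1
      · rw [rImplication_one_left hone hb, hone b hb]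
      rcases hI.1.eq_or_lt with hI0 | hI0
      · rw [← hI0]
        exact ((hA.2.2.2.1 a ha 1 one_mem 0 zero_mem ha.2).trans_eq
          (hone 0 zero_mem)).trans hb.1
      rcases hI.2.eq_or_lt with hI1 | hI1
      · rw [hI1, (hAneut a ha).2]
        exact (hOP a ha b hb).1 hI1
      exact absurd ⟨⟨ha0, ha1⟩, hI0, hI1⟩ hab
end

section
/- Let N be a strong fuzzy negation (N is a fuzzy negation with N(N(x)) = x for all x ∈ [0,1]) and let I be a fuzzy implication fulfilling the law of contraposition (CP(N)) with N, i.e., I(x,y) = I(N(y), N(x)) for all x, y ∈ [0,1]. If I satisfies (A5) with an aggregation function A, then I satisfies (A4) with the same A and with N. -/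
open Set
open scoped ENNReal

/-- Let `N` be a strong fuzzy negation and `I` a fuzzy implication
fulfilling (CP(N)): `I x y = I (N y) (N x)`. If `I` satisfies (A5) with an aggregation
function `A`, then `I` satisfies (A4) with the same `A` and with `N`. -/
theorem stmt19 (I A : ℝ → ℝ → ℝ) (N : ℝ → ℝ)
    (hI : IsFuzzyImplication I) (hA : IsAggregation A)
    (hN : IsFuzzyNegation N) (hNstrong : ∀ x ∈ Icc (0:ℝ) 1, N (N x) = x)
    (hCP : ∀ x ∈ Icc (0:ℝ) 1, ∀ y ∈ Icc (0:ℝ) 1, I x y = I (N y) (N x))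
    (h5 : SatisfiesA5 I A) : SatisfiesA4 I A N := by
  intro a ha
  rw [← h5 (N a) (hN.1 a ha)]
  have hmaps : MapsTo N (Icc 0 1) (Icc 0 1) := hN.1
  have himage : N '' Icc (0:ℝ) 1 = Icc 0 1 :=
    hmaps.image_subset.antisymm fun x hx => ⟨N x, hmaps hx, hNstrong x hx⟩
  conv_rhs => rw [← himage, image_image]
  exact congrArg sSup (image_congr fun b hb => congrArg (A (N b)) (hCP a ha b hb))
end
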